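/- Suppose that for some N ≥ 1 the Riccati equation (ODE-P) has a solution 𝐏 on [0, T]. Then the linear terminal value problem (ODE-S) has a unique solution 𝐒 on [0, T], and there exists S^N : [0,T] → ℝ^n such that 𝐒(t) = (S^N(t)ᵀ, …, S^N(t)ᵀ)ᵀ, i.e., all N blocks of 𝐒(t) in ℝ^n are equal, for every t ∈ [0,T]. -/

import Mathlib

open Matrix Set

namespace LQ

/-- Frobenius norm of a real matrix. -/
noncomputable def frob {a b : Type*} [Fintype a] [Fintype b] (M : Matrix a b ℝ) : ℝ :=
  Real.sqrt (∑ i, ∑ j, (M i j) ^ 2)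

/-- Entrywise ℓ₁ norm of a real matrix. -/
noncomputable def l1norm {a b : Type*} [Fintype a] [Fintype b] (M : Matrix a b ℝ) : ℝ :=
  ∑ i, ∑ j, |M i j|

/-- Block matrix with all diagonal m×m blocks equal to `F` and all off-diagonal blocks equal to `K`. -/
def blockConst (N m : ℕ) (F K : Matrix (Fin m) (Fin m) ℝ) :
    Matrix (Fin N × Fin m) (Fin N × Fin m) ℝ :=
  Matrix.of fun x y => if x.1 = y.1 then F x.2 y.2 else K x.2 y.2

/-- Block matrix with diagonal blocks `Λ₁` and off-diagonal blocks `Λ₂ / N`. -/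
noncomputable def blockPN (N n : ℕ) (Λ₁ Λ₂ : Matrix (Fin n) (Fin n) ℝ) :
    Matrix (Fin N × Fin n) (Fin N × Fin n) ℝ :=
  Matrix.of fun x y => if x.1 = y.1 then Λ₁ x.2 y.2 else Λ₂ x.2 y.2 / (N : ℝ)

/-- The permutation matrix exchanging the i-th and j-th block rows of `I_{Nn}`. -/
def Jswap (N n : ℕ) (i j : Fin N) : Matrix (Fin N × Fin n) (Fin N × Fin n) ℝ :=
  Matrix.of fun x y => if y.1 = Equiv.swap i j x.1 ∧ y.2 = x.2 then 1 else 0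

/-- `I_N ⊗ M`. -/
def kronIN (N : ℕ) {a b : ℕ} (M : Matrix (Fin a) (Fin b) ℝ) :
    Matrix (Fin N × Fin a) (Fin N × Fin b) ℝ :=
  Matrix.of fun x y => if x.1 = y.1 then M x.2 y.2 else 0

/-- `𝟏_{N×1} ⊗ M`. -/
def stackN (N : ℕ) {a b : ℕ} (M : Matrix (Fin a) (Fin b) ℝ) :
    Matrix (Fin N × Fin a) (Fin b) ℝ :=
  Matrix.of fun x y => M x.2 y

/-- Data of the LQ mean field social optimization problem. -/
structure Params (n n₁ : ℕ) where
  A : Matrix (Fin n) (Fin n) ℝ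
  G : Matrix (Fin n) (Fin n) ℝ
  Γ : Matrix (Fin n) (Fin n) ℝ
  Γf : Matrix (Fin n) (Fin n) ℝ
  B : Matrix (Fin n) (Fin n₁) ℝ
  B0 : Matrix (Fin n) (Fin n₁) ℝ
  B1 : Matrix (Fin n) (Fin n₁) ℝ
  D : Matrix (Fin n) (Fin 1) ℝ
  D0 : Matrix (Fin n) (Fin 1) ℝ
  Q : Matrix (Fin n) (Fin n) ℝ
  Qf : Matrix (Fin n) (Fin n) ℝ
  R : Matrix (Fin n₁) (Fin n₁) ℝ
  T : ℝ

namespace Params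

variable {n n₁ : ℕ} (p : Params n n₁)

/-- Standing hypotheses: positive dimensions, positive horizon, symmetric weights. -/
def Standing : Prop :=
  1 ≤ n ∧ 1 ≤ n₁ ∧ 0 < p.T ∧ p.Q.IsSymm ∧ p.Qf.IsSymm ∧ p.R.IsSymm

/-- Q^Γ = Γᵀ Q Γ − Q Γ − Γᵀ Q. -/
def QΓ : Matrix (Fin n) (Fin n) ℝ := p.Γᵀ * p.Q * p.Γ - p.Q * p.Γ - p.Γᵀ * p.Q

/-- Q_f^Γ = Γ_fᵀ Q_f Γ_f − Q_f Γ_f − Γ_fᵀ Q_f. -/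
def QfΓ : Matrix (Fin n) (Fin n) ℝ := p.Γfᵀ * p.Qf * p.Γf - p.Qf * p.Γf - p.Γfᵀ * p.Qf

/-- ℛ₁(Λ₁) = R + B₁ᵀ Λ₁ B₁. -/
def R1 (Λ₁ : Matrix (Fin n) (Fin n) ℝ) : Matrix (Fin n₁) (Fin n₁) ℝ :=
  p.R + p.B1ᵀ * Λ₁ * p.B1

/-- ℛ₂(Λ₁,Λ₂) = R + B₁ᵀ Λ₁ B₁ + B₀ᵀ(Λ₁+Λ₂)B₀. -/
def R2 (Λ₁ Λ₂ : Matrix (Fin n) (Fin n) ℝ) : Matrix (Fin n₁) (Fin n₁) ℝ :=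
  p.R + p.B1ᵀ * Λ₁ * p.B1 + p.B0ᵀ * (Λ₁ + Λ₂) * p.B0

/-- Ψ₁. -/
noncomputable def Ψ₁ (Λ₁ : Matrix (Fin n) (Fin n) ℝ) : Matrix (Fin n) (Fin n) ℝ :=
  Λ₁ * p.B * (p.R1 Λ₁)⁻¹ * p.Bᵀ * Λ₁ - Λ₁ * p.A - p.Aᵀ * Λ₁ - p.Q

/-- Ψ₂. -/
noncomputable def Ψ₂ (Λ₁ Λ₂ : Matrix (Fin n) (Fin n) ℝ) : Matrix (Fin n) (Fin n) ℝ :=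
  (Λ₁ + Λ₂) * p.B * (p.R2 Λ₁ Λ₂)⁻¹ * p.Bᵀ * (Λ₁ + Λ₂)
    - Λ₁ * p.B * (p.R1 Λ₁)⁻¹ * p.Bᵀ * Λ₁
    - (Λ₁ * p.G + Λ₂ * (p.A + p.G))
    - (p.Gᵀ * Λ₁ + (p.Aᵀ + p.Gᵀ) * Λ₂)
    - p.QΓ

/-- Solution of the limiting ODE system (ODE-Λ) on [0,T]. -/
noncomputable def IsSolLim (Λ₁ Λ₂ : ℝ → Matrix (Fin n) (Fin n) ℝ) : Prop :=
  (∀ t ∈ Icc (0 : ℝ) p.T, (Λ₁ t).IsSymm ∧ (Λ₂ t).IsSymm) ∧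
  (∀ t ∈ Icc (0 : ℝ) p.T, (p.R1 (Λ₁ t)).PosDef ∧ (p.R2 (Λ₁ t) (Λ₂ t)).PosDef) ∧
  Λ₁ p.T = p.Qf ∧ Λ₂ p.T = p.QfΓ ∧
  (∀ t ∈ Icc (0 : ℝ) p.T, ∀ i j, HasDerivWithinAt (fun s => Λ₁ s i j)
    (p.Ψ₁ (Λ₁ t) i j) (Icc (0 : ℝ) p.T) t) ∧
  (∀ t ∈ Icc (0 : ℝ) p.T, ∀ i j, HasDerivWithinAt (fun s => Λ₂ s i j)
    (p.Ψ₂ (Λ₁ t) (Λ₂ t) i j) (Icc (0 : ℝ) p.T) t)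

/-! Big (N-agent) matrices. -/

noncomputable def bigA (N : ℕ) : Matrix (Fin N × Fin n) (Fin N × Fin n) ℝ :=
  Matrix.of fun x y => (if x.1 = y.1 then p.A x.2 y.2 else 0) + p.G x.2 y.2 / (N : ℝ)

def bigBhat (N : ℕ) : Matrix (Fin N × Fin n) (Fin N × Fin n₁) ℝ :=
  Matrix.of fun x y => if x.1 = y.1 then p.B x.2 y.2 else 0

def bigB (N : ℕ) (i : Fin N) : Matrix (Fin N × Fin n) (Fin n₁) ℝ :=
  Matrix.of fun x l => if x.1 = i then p.B1 x.2 l else 0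

noncomputable def bigB0 (N : ℕ) : Matrix (Fin N × Fin n) (Fin n₁) ℝ :=
  Matrix.of fun x l => p.B0 x.2 l / (N : ℝ)

def bigD (N : ℕ) (i : Fin N) : Matrix (Fin N × Fin n) (Fin 1) ℝ :=
  Matrix.of fun x l => if x.1 = i then p.D x.2 l else 0

def bigD0 (N : ℕ) : Matrix (Fin N × Fin n) (Fin 1) ℝ :=
  Matrix.of fun x l => p.D0 x.2 l

def bigE (_p : Params n n₁) (N : ℕ) (i : Fin N) : Matrix (Fin n₁) (Fin N × Fin n₁) ℝ :=
  Matrix.of fun k y => if y.1 = i ∧ y.2 = k then 1 else 0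

def bigIhat (_p : Params n n₁) (N : ℕ) : Matrix (Fin n₁) (Fin N × Fin n₁) ℝ :=
  Matrix.of fun k y => if y.2 = k then 1 else 0

noncomputable def bigQ (N : ℕ) : Matrix (Fin N × Fin n) (Fin N × Fin n) ℝ :=
  Matrix.of fun x y => (if x.1 = y.1 then p.Q x.2 y.2 else 0) + p.QΓ x.2 y.2 / (N : ℝ)

noncomputable def bigQf (N : ℕ) : Matrix (Fin N × Fin n) (Fin N × Fin n) ℝ :=
  Matrix.of fun x y => (if x.1 = y.1 then p.Qf x.2 y.2 else 0) + p.QfΓ x.2 y.2 / (N : ℝ)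

def bigR (N : ℕ) : Matrix (Fin N × Fin n₁) (Fin N × Fin n₁) ℝ :=
  Matrix.of fun x y => if x.1 = y.1 then p.R x.2 y.2 else 0

/-- 𝓜₀. -/
noncomputable def M0 (N : ℕ) (Z : Matrix (Fin N × Fin n) (Fin N × Fin n) ℝ) :
    Matrix (Fin 1) (Fin 1) ℝ :=
  (1 / 2 : ℝ) • (∑ i : Fin N, (p.bigD N i)ᵀ * Z * p.bigD N i)
    + (1 / 2 : ℝ) • ((p.bigD0 N)ᵀ * Z * p.bigD0 N)

/-- 𝓜₁. -/
noncomputable def M1 (N : ℕ) (Z : Matrix (Fin N × Fin n) (Fin N × Fin n) ℝ) :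
    Matrix (Fin 1) (Fin N × Fin n₁) ℝ :=
  (∑ i : Fin N, (p.bigD N i)ᵀ * Z * p.bigB N i * p.bigE N i)
    + (p.bigD0 N)ᵀ * Z * p.bigB0 N * p.bigIhat N

/-- 𝓜₂. -/
noncomputable def M2 (N : ℕ) (Z : Matrix (Fin N × Fin n) (Fin N × Fin n) ℝ) :
    Matrix (Fin N × Fin n₁) (Fin N × Fin n₁) ℝ :=
  (1 / 2 : ℝ) • (∑ i : Fin N, (p.bigE N i)ᵀ * (p.bigB N i)ᵀ * Z * p.bigB N i * p.bigE N i)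
    + (1 / 2 : ℝ) • ((p.bigIhat N)ᵀ * (p.bigB0 N)ᵀ * Z * p.bigB0 N * p.bigIhat N)

/-- Right-hand side of the Riccati equation (ODE-P). -/
noncomputable def PRic (N : ℕ) (P : Matrix (Fin N × Fin n) (Fin N × Fin n) ℝ) :
    Matrix (Fin N × Fin n) (Fin N × Fin n) ℝ :=
  P * p.bigBhat N * (p.bigR N + (2 : ℝ) • p.M2 N P)⁻¹ * (p.bigBhat N)ᵀ * P
    - P * p.bigA N - (p.bigA N)ᵀ * P - p.bigQ N

/-- Solution of the large-scale Riccati equation (ODE-P) on [0,T]. -/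
noncomputable def IsSolP (N : ℕ) (P : ℝ → Matrix (Fin N × Fin n) (Fin N × Fin n) ℝ) : Prop :=
  (∀ t ∈ Icc (0 : ℝ) p.T, (P t).IsSymm) ∧
  (∀ t ∈ Icc (0 : ℝ) p.T, (p.bigR N + (2 : ℝ) • p.M2 N (P t)).PosDef) ∧
  P p.T = p.bigQf N ∧
  (∀ t ∈ Icc (0 : ℝ) p.T, ∀ x y, HasDerivWithinAt (fun s => P s x y)
    (p.PRic N (P t) x y) (Icc (0 : ℝ) p.T) t)

/-- Solution of the companion linear equation (ODE-S) on [0,T], relative to `P`. -/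
noncomputable def IsSolS (N : ℕ) (P : ℝ → Matrix (Fin N × Fin n) (Fin N × Fin n) ℝ)
    (S : ℝ → Matrix (Fin N × Fin n) (Fin 1) ℝ) : Prop :=
  S p.T = 0 ∧
  (∀ t ∈ Icc (0 : ℝ) p.T, ∀ x y, HasDerivWithinAt (fun s => S s x y)
    ((P t * p.bigBhat N * (p.bigR N + (2 : ℝ) • p.M2 N (P t))⁻¹ *
        ((p.bigBhat N)ᵀ * S t + (p.M1 N (P t))ᵀ) - (p.bigA N)ᵀ * S t) x y)
    (Icc (0 : ℝ) p.T) t)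

/-- Solution of the companion scalar equation (ODE-r) on [0,T], relative to `P` and `S`. -/
noncomputable def IsSolr (N : ℕ) (P : ℝ → Matrix (Fin N × Fin n) (Fin N × Fin n) ℝ)
    (S : ℝ → Matrix (Fin N × Fin n) (Fin 1) ℝ) (r : ℝ → ℝ) : Prop :=
  r p.T = 0 ∧
  (∀ t ∈ Icc (0 : ℝ) p.T, HasDerivWithinAt r
    (((((S t)ᵀ * p.bigBhat N + p.M1 N (P t)) * (p.bigR N + (2 : ℝ) • p.M2 N (P t))⁻¹ *
        ((p.bigBhat N)ᵀ * S t + (p.M1 N (P t))ᵀ)) - (2 : ℝ) • p.M0 N (P t)) 0 0)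
    (Icc (0 : ℝ) p.T) t)

/-- Asymptotic solvability of the LQ mean field social optimization problem. -/
noncomputable def AsympSolvable : Prop :=
  ∃ N₀ : ℕ, 1 ≤ N₀ ∧ ∃ c₀ : ℝ, 0 < c₀ ∧ ∃ C : ℝ,
    ∀ N : ℕ, N₀ ≤ N →
      ∃ P : ℝ → Matrix (Fin N × Fin n) (Fin N × Fin n) ℝ,
        p.IsSolP N P ∧
        (∀ t ∈ Icc (0 : ℝ) p.T, l1norm (P t) / (N : ℝ) ≤ C) ∧
        (∀ t ∈ Icc (0 : ℝ) p.T,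
          (p.bigR N + (2 : ℝ) • p.M2 N (P t) - c₀ • 1).PosSemidef)

/-! The rescaled low-dimensional system. -/

/-- E^N. -/
noncomputable def EN (N : ℕ) (Λ₁ Λ₂ : Matrix (Fin n) (Fin n) ℝ) :
    Matrix (Fin n₁) (Fin n₁) ℝ :=
  (1 / (N : ℝ)) •
    ((p.R2 Λ₁ Λ₂ - (1 / (N : ℝ)) • (p.B0ᵀ * Λ₂ * p.B0))⁻¹ - (p.R1 Λ₁)⁻¹)

/-- H^N. -/
noncomputable def HN (N : ℕ) (Λ₁ Λ₂ : Matrix (Fin n) (Fin n) ℝ) :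
    Matrix (Fin n₁) (Fin n₁) ℝ :=
  p.EN N Λ₁ Λ₂ + (p.R1 Λ₁)⁻¹

/-- g₁. -/
noncomputable def g₁ (N : ℕ) (Λ₁ Λ₂ : Matrix (Fin n) (Fin n) ℝ) :
    Matrix (Fin n) (Fin n) ℝ :=
  Λ₁ * p.B * p.EN N Λ₁ Λ₂ * p.Bᵀ * Λ₁
  + (1 - 1 / (N : ℝ)) •
      (Λ₂ * p.B * p.EN N Λ₁ Λ₂ * p.Bᵀ * Λ₁ + Λ₁ * p.B * p.EN N Λ₁ Λ₂ * p.Bᵀ * Λ₂)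
  + (1 / (N : ℝ) - 1 / (N : ℝ) ^ 2) •
      (Λ₂ * p.B * (p.HN N Λ₁ Λ₂ + ((N : ℝ) - 2) • p.EN N Λ₁ Λ₂) * p.Bᵀ * Λ₂)
  - (1 / (N : ℝ)) •
      ((Λ₁ * p.G + p.Gᵀ * Λ₁) + (1 - 1 / (N : ℝ)) • (Λ₂ * p.G + p.Gᵀ * Λ₂))
  - (1 / (N : ℝ)) • p.QΓ

/-- g₂. -/
noncomputable def g₂ (N : ℕ) (Λ₁ Λ₂ : Matrix (Fin n) (Fin n) ℝ) :
    Matrix (Fin n) (Fin n) ℝ :=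
  (Λ₁ + Λ₂) * p.B *
      ((N : ℝ) • p.EN N Λ₁ Λ₂ + (p.R1 Λ₁)⁻¹ - (p.R2 Λ₁ Λ₂)⁻¹) * p.Bᵀ * (Λ₁ + Λ₂)
  - (2 / (N : ℝ)) • (Λ₂ * p.B * (p.R1 Λ₁)⁻¹ * p.Bᵀ * Λ₂)
  + (1 / (N : ℝ) - 2) • (Λ₂ * p.B * p.EN N Λ₁ Λ₂ * p.Bᵀ * Λ₂)
  - Λ₁ * p.B * p.EN N Λ₁ Λ₂ * p.Bᵀ * Λ₂
  - Λ₂ * p.B * p.EN N Λ₁ Λ₂ * p.Bᵀ * Λ₁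
  + (1 / (N : ℝ)) • (Λ₂ * p.G + p.Gᵀ * Λ₂)

/-- Solution of the rescaled system (ODE-Λ^N) on [0,T]. -/
noncomputable def IsSolLamN (N : ℕ) (Λ₁ Λ₂ : ℝ → Matrix (Fin n) (Fin n) ℝ) : Prop :=
  (∀ t ∈ Icc (0 : ℝ) p.T, (Λ₁ t).IsSymm ∧ (Λ₂ t).IsSymm) ∧
  (∀ t ∈ Icc (0 : ℝ) p.T, (p.R1 (Λ₁ t)).PosDef ∧ (p.R2 (Λ₁ t) (Λ₂ t)).PosDef ∧
    (p.R2 (Λ₁ t) (Λ₂ t) - (1 / (N : ℝ)) • (p.B0ᵀ * Λ₂ t * p.B0)).PosDef) ∧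
  Λ₁ p.T = p.Qf + (1 / (N : ℝ)) • p.QfΓ ∧ Λ₂ p.T = p.QfΓ ∧
  (∀ t ∈ Icc (0 : ℝ) p.T, ∀ i j, HasDerivWithinAt (fun s => Λ₁ s i j)
    ((p.Ψ₁ (Λ₁ t) + p.g₁ N (Λ₁ t) (Λ₂ t)) i j) (Icc (0 : ℝ) p.T) t) ∧
  (∀ t ∈ Icc (0 : ℝ) p.T, ∀ i j, HasDerivWithinAt (fun s => Λ₂ s i j)
    ((p.Ψ₂ (Λ₁ t) (Λ₂ t) + p.g₂ N (Λ₁ t) (Λ₂ t)) i j) (Icc (0 : ℝ) p.T) t)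

/-! Companion (mean-field) equations. -/

/-- φ₁. -/
noncomputable def φ₁ (Λ₁ Λ₂ : Matrix (Fin n) (Fin n) ℝ) (S : Matrix (Fin n) (Fin 1) ℝ) :
    Matrix (Fin n) (Fin 1) ℝ :=
  (Λ₁ + Λ₂) * p.B * (p.R2 Λ₁ Λ₂)⁻¹ *
      (p.Bᵀ * S + p.B1ᵀ * Λ₁ * p.D + p.B0ᵀ * (Λ₁ + Λ₂) * p.D0)
    - (p.A + p.G)ᵀ * S

/-- φ₂. -/
noncomputable def φ₂ (Λ₁ Λ₂ : Matrix (Fin n) (Fin n) ℝ) (S : Matrix (Fin n) (Fin 1) ℝ) :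
    Matrix (Fin 1) (Fin 1) ℝ :=
  (Sᵀ * p.B + p.Dᵀ * Λ₁ * p.B1 + p.D0ᵀ * (Λ₁ + Λ₂) * p.B0) * (p.R2 Λ₁ Λ₂)⁻¹ *
      (p.Bᵀ * S + p.B1ᵀ * Λ₁ * p.D + p.B0ᵀ * (Λ₁ + Λ₂) * p.D0)
    - p.Dᵀ * Λ₁ * p.D - p.D0ᵀ * (Λ₁ + Λ₂) * p.D0

/-- Solution of the limiting companion system (ODE-Sr) on [0,T]. -/
noncomputable def IsSolSr (Λ₁ Λ₂ : ℝ → Matrix (Fin n) (Fin n) ℝ)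
    (S : ℝ → Matrix (Fin n) (Fin 1) ℝ) (r : ℝ → ℝ) : Prop :=
  S p.T = 0 ∧ r p.T = 0 ∧
  (∀ t ∈ Icc (0 : ℝ) p.T, ∀ i j, HasDerivWithinAt (fun s => S s i j)
    (p.φ₁ (Λ₁ t) (Λ₂ t) (S t) i j) (Icc (0 : ℝ) p.T) t) ∧
  (∀ t ∈ Icc (0 : ℝ) p.T, HasDerivWithinAt r
    ((p.φ₂ (Λ₁ t) (Λ₂ t) (S t)) 0 0) (Icc (0 : ℝ) p.T) t)

/-- g₀₁. -/
noncomputable def g01 (N : ℕ) (Λ₁ Λ₂ : Matrix (Fin n) (Fin n) ℝ)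
    (S : Matrix (Fin n) (Fin 1) ℝ) : Matrix (Fin n) (Fin 1) ℝ :=
  (Λ₁ + (1 - 1 / (N : ℝ)) • Λ₂) * p.B *
      (p.R2 Λ₁ Λ₂ - (1 / (N : ℝ)) • (p.B0ᵀ * Λ₂ * p.B0))⁻¹ *
      (p.Bᵀ * S + p.B1ᵀ * Λ₁ * p.D + p.B0ᵀ * (Λ₁ + (1 - 1 / (N : ℝ)) • Λ₂) * p.D0)
  - (Λ₁ + Λ₂) * p.B * (p.R2 Λ₁ Λ₂)⁻¹ *
      (p.Bᵀ * S + p.B1ᵀ * Λ₁ * p.D + p.B0ᵀ * (Λ₁ + Λ₂) * p.D0)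

/-- g₀₂. -/
noncomputable def g02 (N : ℕ) (Λ₁ Λ₂ : Matrix (Fin n) (Fin n) ℝ)
    (S : Matrix (Fin n) (Fin 1) ℝ) : Matrix (Fin 1) (Fin 1) ℝ :=
  (Sᵀ * p.B + p.Dᵀ * Λ₁ * p.B1 + p.D0ᵀ * (Λ₁ + (1 - 1 / (N : ℝ)) • Λ₂) * p.B0) *
      (p.R2 Λ₁ Λ₂ - (1 / (N : ℝ)) • (p.B0ᵀ * Λ₂ * p.B0))⁻¹ *
      (p.Bᵀ * S + p.B1ᵀ * Λ₁ * p.D + p.B0ᵀ * (Λ₁ + (1 - 1 / (N : ℝ)) • Λ₂) * p.D0)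
  - (Sᵀ * p.B + p.Dᵀ * Λ₁ * p.B1 + p.D0ᵀ * (Λ₁ + Λ₂) * p.B0) * (p.R2 Λ₁ Λ₂)⁻¹ *
      (p.Bᵀ * S + p.B1ᵀ * Λ₁ * p.D + p.B0ᵀ * (Λ₁ + Λ₂) * p.D0)
  + (1 / (N : ℝ)) • (p.D0ᵀ * Λ₂ * p.D0)

/-- Solution of the rescaled companion system (ODE-S^N r^N) on [0,T]. -/
noncomputable def IsSolSrN (N : ℕ) (Λ₁ Λ₂ : ℝ → Matrix (Fin n) (Fin n) ℝ)
    (S : ℝ → Matrix (Fin n) (Fin 1) ℝ) (r : ℝ → ℝ) : Prop :=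
  S p.T = 0 ∧ r p.T = 0 ∧
  (∀ t ∈ Icc (0 : ℝ) p.T, ∀ i j, HasDerivWithinAt (fun s => S s i j)
    ((p.φ₁ (Λ₁ t) (Λ₂ t) (S t) + p.g01 N (Λ₁ t) (Λ₂ t) (S t)) i j) (Icc (0 : ℝ) p.T) t) ∧
  (∀ t ∈ Icc (0 : ℝ) p.T, HasDerivWithinAt r
    ((p.φ₂ (Λ₁ t) (Λ₂ t) (S t) + p.g02 N (Λ₁ t) (Λ₂ t) (S t)) 0 0) (Icc (0 : ℝ) p.T) t)

/-! Feedback gains. -/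

/-- Θ = ℛ₁(Λ₁)⁻¹ Bᵀ Λ₁. -/
noncomputable def Theta (Λ₁ : Matrix (Fin n) (Fin n) ℝ) : Matrix (Fin n₁) (Fin n) ℝ :=
  (p.R1 Λ₁)⁻¹ * p.Bᵀ * Λ₁

/-- Θ₁ = (H₁ − H)Bᵀ(Λ₁+Λ₂) + HBᵀΛ₂. -/
noncomputable def Theta1 (Λ₁ Λ₂ : Matrix (Fin n) (Fin n) ℝ) : Matrix (Fin n₁) (Fin n) ℝ :=
  ((p.R2 Λ₁ Λ₂)⁻¹ - (p.R1 Λ₁)⁻¹) * p.Bᵀ * (Λ₁ + Λ₂) + (p.R1 Λ₁)⁻¹ * p.Bᵀ * Λ₂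

/-- Θ₂ = H₁[BᵀS + B₁ᵀΛ₁D + B₀ᵀ(Λ₁+Λ₂)D₀]. -/
noncomputable def Theta2 (Λ₁ Λ₂ : Matrix (Fin n) (Fin n) ℝ) (S : Matrix (Fin n) (Fin 1) ℝ) :
    Matrix (Fin n₁) (Fin 1) ℝ :=
  (p.R2 Λ₁ Λ₂)⁻¹ * (p.Bᵀ * S + p.B1ᵀ * Λ₁ * p.D + p.B0ᵀ * (Λ₁ + Λ₂) * p.D0)

/-- Θ^N. -/
noncomputable def ThetaN (N : ℕ) (Λ₁ Λ₂ : Matrix (Fin n) (Fin n) ℝ) :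
    Matrix (Fin n₁) (Fin n) ℝ :=
  (p.HN N Λ₁ Λ₂ - p.EN N Λ₁ Λ₂) * p.Bᵀ * (Λ₁ - (1 / (N : ℝ)) • Λ₂)

/-- Θ₁^N. -/
noncomputable def Theta1N (N : ℕ) (Λ₁ Λ₂ : Matrix (Fin n) (Fin n) ℝ) :
    Matrix (Fin n₁) (Fin n) ℝ :=
  (N : ℝ) • (p.EN N Λ₁ Λ₂ * p.Bᵀ * Λ₁)
    + (p.HN N Λ₁ Λ₂ + ((N : ℝ) - 2) • p.EN N Λ₁ Λ₂) * p.Bᵀ * Λ₂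

/-- Θ₂^N. -/
noncomputable def Theta2N (N : ℕ) (Λ₁ Λ₂ : Matrix (Fin n) (Fin n) ℝ)
    (S : Matrix (Fin n) (Fin 1) ℝ) : Matrix (Fin n₁) (Fin 1) ℝ :=
  (p.HN N Λ₁ Λ₂ + ((N : ℝ) - 1) • p.EN N Λ₁ Λ₂) *
    (p.Bᵀ * S + p.B1ᵀ * Λ₁ * p.D + p.B0ᵀ * (Λ₁ + (1 - 1 / (N : ℝ)) • Λ₂) * p.D0)

/-- Z₀ = −B₀(Θ + Θ₁). -/
noncomputable def Z0 (Λ₁ Λ₂ : Matrix (Fin n) (Fin n) ℝ) : Matrix (Fin n) (Fin n) ℝ :=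
  -(p.B0 * (p.Theta Λ₁ + p.Theta1 Λ₁ Λ₂))

/-- Z₁ = A + G − B(Θ + Θ₁). -/
noncomputable def Z1 (Λ₁ Λ₂ : Matrix (Fin n) (Fin n) ℝ) : Matrix (Fin n) (Fin n) ℝ :=
  p.A + p.G - p.B * (p.Theta Λ₁ + p.Theta1 Λ₁ Λ₂)

/-! The high-dimensional equations under the decentralized control. -/

/-- RHS of (ODE-P̌₁) (paper's −d𝐏̌₁/dt). -/
noncomputable def Pcheck1RHS (N : ℕ) (Θ : Matrix (Fin n₁) (Fin n) ℝ)
    (P1 : Matrix (Fin N × Fin n) (Fin N × Fin n) ℝ) :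
    Matrix (Fin N × Fin n) (Fin N × Fin n) ℝ :=
  (kronIN N Θ)ᵀ * (p.bigR N + p.M2 N ((2 : ℝ) • P1)) * kronIN N Θ
    + P1 * (p.bigA N - p.bigBhat N * kronIN N Θ)
    + (p.bigA N - p.bigBhat N * kronIN N Θ)ᵀ * P1
    + p.bigQ N

/-- Solution of (ODE-P̌₁) on [0,T], with Θ(t) built from Λ₁(t). -/
noncomputable def IsSolPcheck1 (N : ℕ) (Λ₁ : ℝ → Matrix (Fin n) (Fin n) ℝ)
    (P1 : ℝ → Matrix (Fin N × Fin n) (Fin N × Fin n) ℝ) : Prop :=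
  P1 p.T = p.bigQf N ∧
  (∀ t ∈ Icc (0 : ℝ) p.T, ∀ x y, HasDerivWithinAt (fun s => P1 s x y)
    ((-(p.Pcheck1RHS N (p.Theta (Λ₁ t)) (P1 t))) x y) (Icc (0 : ℝ) p.T) t)

/-- RHS of (ODE-P̌₁₂) (paper's −d𝐏̌₁₂/dt). -/
noncomputable def Pcheck12RHS (N : ℕ) (Λ₁m Λ₂m : Matrix (Fin n) (Fin n) ℝ)
    (P1 : Matrix (Fin N × Fin n) (Fin N × Fin n) ℝ)
    (P12 : Matrix (Fin N × Fin n) (Fin n) ℝ) :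
    Matrix (Fin N × Fin n) (Fin n) ℝ :=
  (kronIN N (p.Theta Λ₁m))ᵀ * (p.bigR N + p.M2 N ((2 : ℝ) • P1)) *
      stackN N (p.Theta1 Λ₁m Λ₂m)
    - P1 * p.bigBhat N * stackN N (p.Theta1 Λ₁m Λ₂m)
    + ((p.bigA N)ᵀ - (kronIN N (p.Theta Λ₁m))ᵀ * (p.bigBhat N)ᵀ) * P12
    + P12 * p.Z1 Λ₁m Λ₂m
    - (kronIN N (p.Theta Λ₁m))ᵀ * (p.bigIhat N)ᵀ * (p.bigB0 N)ᵀ * P12 * p.Z0 Λ₁m Λ₂m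

/-- Solution of (ODE-P̌₁₂) on [0,T]. -/
noncomputable def IsSolPcheck12 (N : ℕ) (Λ₁ Λ₂ : ℝ → Matrix (Fin n) (Fin n) ℝ)
    (P1 : ℝ → Matrix (Fin N × Fin n) (Fin N × Fin n) ℝ)
    (P12 : ℝ → Matrix (Fin N × Fin n) (Fin n) ℝ) : Prop :=
  P12 p.T = 0 ∧
  (∀ t ∈ Icc (0 : ℝ) p.T, ∀ x y, HasDerivWithinAt (fun s => P12 s x y)
    ((-(p.Pcheck12RHS N (Λ₁ t) (Λ₂ t) (P1 t) (P12 t))) x y) (Icc (0 : ℝ) p.T) t)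

/-! The decentralized-control low-dimensional coefficient system. -/

/-- ǧ₁. -/
noncomputable def gc1 (N : ℕ) (Θ : Matrix (Fin n₁) (Fin n) ℝ)
    (L1 L2 : Matrix (Fin n) (Fin n) ℝ) : Matrix (Fin n) (Fin n) ℝ :=
  (1 / (N : ℝ)) •
    (Θᵀ * p.B0ᵀ * (L1 + (1 - 1 / (N : ℝ)) • L2) * p.B0 * Θ
      + (L1 + (1 - 1 / (N : ℝ)) • L2) * p.G
      + p.Gᵀ * (L1 + (1 - 1 / (N : ℝ)) • L2)
      + p.QΓ)

/-- ǧ₂. -/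
noncomputable def gc2 (N : ℕ) (Θ : Matrix (Fin n₁) (Fin n) ℝ)
    (L2 : Matrix (Fin n) (Fin n) ℝ) : Matrix (Fin n) (Fin n) ℝ :=
  -((1 / (N : ℝ)) • (Θᵀ * p.B0ᵀ * L2 * p.B0 * Θ + L2 * p.G + p.Gᵀ * L2))

/-- ǧ₁₂. -/
noncomputable def gc12 (N : ℕ) (Θ Θ₁ : Matrix (Fin n₁) (Fin n) ℝ)
    (L2 : Matrix (Fin n) (Fin n) ℝ) : Matrix (Fin n) (Fin n) ℝ :=
  (1 / (N : ℝ)) • (-(Θᵀ * p.B0ᵀ * L2 * p.B0 * Θ₁) + L2 * p.B * Θ₁)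

/-- ǧ₂₂. -/
noncomputable def gc22 (N : ℕ) (Θ₁ : Matrix (Fin n₁) (Fin n) ℝ)
    (L2 : Matrix (Fin n) (Fin n) ℝ) : Matrix (Fin n) (Fin n) ℝ :=
  -((1 / (N : ℝ)) • (Θ₁ᵀ * p.B0ᵀ * L2 * p.B0 * Θ₁))

/-- ǧ₀₁. -/
noncomputable def gc01 (N : ℕ) (Θ : Matrix (Fin n₁) (Fin n) ℝ)
    (Θ₂ : Matrix (Fin n₁) (Fin 1) ℝ) (L2 : Matrix (Fin n) (Fin n) ℝ) :
    Matrix (Fin n) (Fin 1) ℝ :=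
  (1 / (N : ℝ)) • (Θᵀ * p.B0ᵀ * L2 * (p.D0 - p.B0 * Θ₂) + L2 * p.B * Θ₂)

/-- ǧ₀₂. -/
noncomputable def gc02 (N : ℕ) (Θ₁ : Matrix (Fin n₁) (Fin n) ℝ)
    (Θ₂ : Matrix (Fin n₁) (Fin 1) ℝ) (L2 : Matrix (Fin n) (Fin n) ℝ) :
    Matrix (Fin n) (Fin 1) ℝ :=
  (1 / (N : ℝ)) • (-(Θ₁ᵀ * p.B0ᵀ * L2 * p.B0 * Θ₂) + Θ₁ᵀ * p.B0ᵀ * L2 * p.D0)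

/-- RHS of (ODE-Λ̌₁^N) (paper's −dΛ̌₁^N/dt). -/
noncomputable def check1RHS (N : ℕ) (Θ : Matrix (Fin n₁) (Fin n) ℝ)
    (L1 L2 : Matrix (Fin n) (Fin n) ℝ) : Matrix (Fin n) (Fin n) ℝ :=
  Θᵀ * p.R1 L1 * Θ + L1 * (p.A - p.B * Θ) + (p.A - p.B * Θ)ᵀ * L1 + p.Q
    + p.gc1 N Θ L1 L2

/-- RHS of (ODE-Λ̌₂^N). -/
noncomputable def check2RHS (N : ℕ) (Θ : Matrix (Fin n₁) (Fin n) ℝ)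
    (L1 L2 : Matrix (Fin n) (Fin n) ℝ) : Matrix (Fin n) (Fin n) ℝ :=
  Θᵀ * p.B0ᵀ * (L1 + L2) * p.B0 * Θ + L1 * p.G + p.Gᵀ * L1
    + L2 * (p.A + p.G - p.B * Θ) + (p.A + p.G - p.B * Θ)ᵀ * L2 + p.QΓ
    + p.gc2 N Θ L2

/-- RHS of (ODE-Λ̌₁₂^N). -/
noncomputable def check12RHS (N : ℕ) (Θ Θ₁ : Matrix (Fin n₁) (Fin n) ℝ)
    (L1 L2 L12 : Matrix (Fin n) (Fin n) ℝ) : Matrix (Fin n) (Fin n) ℝ :=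
  Θᵀ * p.R2 L1 L2 * Θ₁ + Θᵀ * p.B0ᵀ * L12 * p.B0 * (Θ + Θ₁)
    - (L1 + L2) * p.B * Θ₁
    + (p.A + p.G - p.B * Θ)ᵀ * L12
    + L12 * (p.A + p.G - p.B * (Θ₁ + Θ))
    + p.gc12 N Θ Θ₁ L2

/-- RHS of (ODE-Λ̌₂₂^N). -/
noncomputable def check22RHS (N : ℕ) (Θ₁ : Matrix (Fin n₁) (Fin n) ℝ)
    (Z₀ Z₁ : Matrix (Fin n) (Fin n) ℝ)
    (L1 L2 L12 L22 : Matrix (Fin n) (Fin n) ℝ) : Matrix (Fin n) (Fin n) ℝ :=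
  Θ₁ᵀ * p.R2 L1 L2 * Θ₁ - L12ᵀ * p.B * Θ₁ - Θ₁ᵀ * p.Bᵀ * L12
    + L22 * Z₁ + Z₁ᵀ * L22
    - Z₀ᵀ * L12ᵀ * p.B0 * Θ₁ - Θ₁ᵀ * p.B0ᵀ * L12 * Z₀
    + Z₀ᵀ * L22 * Z₀ + p.gc22 N Θ₁ L2

/-- RHS of (ODE-Š₁^N). -/
noncomputable def checkS1RHS (N : ℕ) (Θ : Matrix (Fin n₁) (Fin n) ℝ)
    (Θ₂ : Matrix (Fin n₁) (Fin 1) ℝ) (L1 L2 L12 : Matrix (Fin n) (Fin n) ℝ)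
    (S1 : Matrix (Fin n) (Fin 1) ℝ) : Matrix (Fin n) (Fin 1) ℝ :=
  Θᵀ * p.R2 L1 L2 * Θ₂ - (L1 + L2 + L12) * p.B * Θ₂
    - Θᵀ * (p.Bᵀ * S1 + p.B1ᵀ * L1 * p.D + p.B0ᵀ * (L1 + L2) * p.D0)
    - Θᵀ * p.B0ᵀ * L12 * (p.D0 - p.B0 * Θ₂)
    + (p.A + p.G)ᵀ * S1
    + p.gc01 N Θ Θ₂ L2

/-- RHS of (ODE-Š₂^N). -/
noncomputable def checkS2RHS (N : ℕ) (Θ₁ : Matrix (Fin n₁) (Fin n) ℝ)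
    (Θ₂ : Matrix (Fin n₁) (Fin 1) ℝ) (Z₀ Z₁ : Matrix (Fin n) (Fin n) ℝ)
    (L1 L2 L12 L22 : Matrix (Fin n) (Fin n) ℝ)
    (S1 S2 : Matrix (Fin n) (Fin 1) ℝ) : Matrix (Fin n) (Fin 1) ℝ :=
  Θ₁ᵀ * p.R2 L1 L2 * Θ₂ + Z₁ᵀ * S2
    - Θ₁ᵀ * (p.Bᵀ * S1 + p.B1ᵀ * L1 * p.D + p.B0ᵀ * (L1 + L2) * p.D0)
    + (Z₀ᵀ * L22 + Z₀ᵀ * L12ᵀ - Θ₁ᵀ * p.B0ᵀ * L12) * (p.D0 - p.B0 * Θ₂)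
    - (L12ᵀ + L22) * p.B * Θ₂
    + p.gc02 N Θ₁ Θ₂ L2

/-- Solution of the pair (ODE-Λ̌₁^N)–(ODE-Λ̌₂^N) on [0,T], with Θ(t) from the limiting Λ₁. -/
noncomputable def IsSolCheckA (N : ℕ) (Λ₁ : ℝ → Matrix (Fin n) (Fin n) ℝ)
    (L1 L2 : ℝ → Matrix (Fin n) (Fin n) ℝ) : Prop :=
  L1 p.T = p.Qf + (1 / (N : ℝ)) • p.QfΓ ∧ L2 p.T = p.QfΓ ∧
  (∀ t ∈ Icc (0 : ℝ) p.T, ∀ i j, HasDerivWithinAt (fun s => L1 s i j)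
    ((-(p.check1RHS N (p.Theta (Λ₁ t)) (L1 t) (L2 t))) i j) (Icc (0 : ℝ) p.T) t) ∧
  (∀ t ∈ Icc (0 : ℝ) p.T, ∀ i j, HasDerivWithinAt (fun s => L2 s i j)
    ((-(p.check2RHS N (p.Theta (Λ₁ t)) (L1 t) (L2 t))) i j) (Icc (0 : ℝ) p.T) t)

/-- Solution of (ODE-Λ̌₁^N)–(ODE-Λ̌₂₂^N) on [0,T], with Θ, Θ₁, Z₀, Z₁ from the limiting (Λ₁, Λ₂). -/
noncomputable def IsSolCheckB (N : ℕ) (Λ₁ Λ₂ : ℝ → Matrix (Fin n) (Fin n) ℝ)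
    (L1 L2 L12 L22 : ℝ → Matrix (Fin n) (Fin n) ℝ) : Prop :=
  p.IsSolCheckA N Λ₁ L1 L2 ∧
  L12 p.T = 0 ∧ L22 p.T = 0 ∧
  (∀ t ∈ Icc (0 : ℝ) p.T, ∀ i j, HasDerivWithinAt (fun s => L12 s i j)
    ((-(p.check12RHS N (p.Theta (Λ₁ t)) (p.Theta1 (Λ₁ t) (Λ₂ t))
        (L1 t) (L2 t) (L12 t))) i j) (Icc (0 : ℝ) p.T) t) ∧
  (∀ t ∈ Icc (0 : ℝ) p.T, ∀ i j, HasDerivWithinAt (fun s => L22 s i j)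
    ((-(p.check22RHS N (p.Theta1 (Λ₁ t) (Λ₂ t)) (p.Z0 (Λ₁ t) (Λ₂ t))
        (p.Z1 (Λ₁ t) (Λ₂ t)) (L1 t) (L2 t) (L12 t) (L22 t))) i j) (Icc (0 : ℝ) p.T) t)

/-- Solution of the full decentralized coefficient system on [0,T],
with Θ, Θ₁, Θ₂, Z₀, Z₁ from the limiting (Λ₁, Λ₂, S). -/
noncomputable def IsSolCheckC (N : ℕ) (Λ₁ Λ₂ : ℝ → Matrix (Fin n) (Fin n) ℝ)
    (S : ℝ → Matrix (Fin n) (Fin 1) ℝ)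
    (L1 L2 L12 L22 : ℝ → Matrix (Fin n) (Fin n) ℝ)
    (S1 S2 : ℝ → Matrix (Fin n) (Fin 1) ℝ) : Prop :=
  p.IsSolCheckB N Λ₁ Λ₂ L1 L2 L12 L22 ∧
  S1 p.T = 0 ∧ S2 p.T = 0 ∧
  (∀ t ∈ Icc (0 : ℝ) p.T, ∀ i j, HasDerivWithinAt (fun s => S1 s i j)
    ((-(p.checkS1RHS N (p.Theta (Λ₁ t)) (p.Theta2 (Λ₁ t) (Λ₂ t) (S t))
        (L1 t) (L2 t) (L12 t) (S1 t))) i j) (Icc (0 : ℝ) p.T) t) ∧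
  (∀ t ∈ Icc (0 : ℝ) p.T, ∀ i j, HasDerivWithinAt (fun s => S2 s i j)
    ((-(p.checkS2RHS N (p.Theta1 (Λ₁ t) (Λ₂ t)) (p.Theta2 (Λ₁ t) (Λ₂ t) (S t))
        (p.Z0 (Λ₁ t) (Λ₂ t)) (p.Z1 (Λ₁ t) (Λ₂ t))
        (L1 t) (L2 t) (L12 t) (L22 t) (S1 t) (S2 t))) i j) (Icc (0 : ℝ) p.T) t)

end Params

section LinearODE

variable {E : Type*} [NormedAddCommGroup E] [NormedSpace ℝ E] [FiniteDimensional ℝ E]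

/-- A family of linear maps that is strongly continuous on a compact interval is uniformly bounded
there. -/
theorem exists_norm_le_of_continuousOn_Icc {a b : ℝ} {L : ℝ → E →ₗ[ℝ] E}
    (hL : ∀ x, ContinuousOn (fun t => L t x) (Icc a b)) :
    ∃ C : NNReal, ∀ t ∈ Icc a b, ∀ x, ‖L t x‖ ≤ C * ‖x‖ := by
  have : CompleteSpace E := FiniteDimensional.complete ℝ E
  obtain ⟨C, hC⟩ := banach_steinhaus
    (g := fun t : Icc a b => LinearMap.toContinuousLinearMap (L t)) (fun x => by
      obtain ⟨C, hC⟩ := isCompact_Icc.exists_bound_of_continuousOn (hL x)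
      exact ⟨C, fun t => hC t t.2⟩)
  refine ⟨C.toNNReal, fun t ht x => ?_⟩
  exact (LinearMap.toContinuousLinearMap (L t)).le_of_opNorm_le
    ((hC ⟨t, ht⟩).trans (Real.le_coe_toNNReal C)) x

/-- There is a bounded Lipschitz map which is the identity on a given ball and does not increase
norms. -/
theorem exists_bounded_lipschitz_retraction {R : ℝ} (hR : 0 < R) :
    ∃ (ρ : E → E) (K M : NNReal), LipschitzWith K ρ ∧ (∀ x, ‖ρ x‖ ≤ M) ∧
      (∀ x, ‖ρ x‖ ≤ ‖x‖) ∧ ∀ x, ‖x‖ ≤ R → ρ x = x := by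
  let χ : ContDiffBump (0 : E) := ⟨R, R + 1, hR, by linarith⟩
  have hcs : HasCompactSupport fun x => χ x • x := χ.hasCompactSupport.smul_right
  have hcd : ContDiff ℝ 1 fun x => χ x • x := χ.contDiff.smul contDiff_id
  obtain ⟨K, hK⟩ := hcd.lipschitzWith_of_hasCompactSupport hcs one_ne_zero
  obtain ⟨M, hM⟩ := hcs.exists_bound_of_continuous hcd.continuous
  refine ⟨_, K, M.toNNReal, hK, fun x => (hM x).trans (Real.le_coe_toNNReal M), fun x => ?_,
    fun x hx => ?_⟩
  · rw [norm_smul, Real.norm_of_nonneg χ.nonneg]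
    exact mul_le_of_le_one_left (norm_nonneg x) χ.le_one
  · rw [χ.one_of_mem_closedBall (by simpa using hx), one_smul]

/-- Global existence for linear initial value problems on a compact interval. -/
theorem exists_linearODE_initial {T : ℝ} (hT : 0 ≤ T) {L : ℝ → E →ₗ[ℝ] E} {b : ℝ → E}
    (hL : ∀ x, ContinuousOn (fun t => L t x) (Icc 0 T)) (hb : ContinuousOn b (Icc 0 T)) :
    ∃ x : ℝ → E, x 0 = 0 ∧
      ∀ t ∈ Icc 0 T, HasDerivWithinAt x (L t (x t) + b t) (Icc 0 T) t := by
  have : CompleteSpace E := FiniteDimensional.complete ℝ E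
  obtain ⟨C, hC⟩ := exists_norm_le_of_continuousOn_Icc hL
  obtain ⟨c', hc'⟩ := isCompact_Icc.exists_bound_of_continuousOn hb
  obtain ⟨c, hc⟩ : ∃ c : NNReal, ∀ t ∈ Icc 0 T, ‖b t‖ ≤ c :=
    ⟨c'.toNNReal, fun t ht => (hc' t ht).trans (Real.le_coe_toNNReal c')⟩
  have hmono := gronwallBound_mono (le_refl 0) c.coe_nonneg C.coe_nonneg
  have hR : 0 < gronwallBound 0 C c T + 1 := by
    have := hmono hT
    rw [gronwallBound_x0] at this
    linarith
  obtain ⟨ρ, K, M, hρK, hρM, hρle, hρid⟩ := exists_bounded_lipschitz_retraction (E := E) hR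
  have hPL : IsPicardLindelof (fun t x => L t (ρ x) + b t) (⟨0, le_rfl, hT⟩ : Icc 0 T) (0 : E)
      ((C * M + c) * T.toNNReal) 0 (C * M + c) (C * K) := by
    refine ⟨fun t ht => ?_, fun x _ => (hL (ρ x)).add hb, fun t ht x _ => ?_, ?_⟩
    · refine LipschitzWith.lipschitzOnWith (LipschitzWith.of_dist_le_mul fun x y => ?_)
      rw [dist_add_right, dist_eq_norm, ← map_sub, NNReal.coe_mul, mul_assoc]
      refine (hC t ht _).trans ?_
      gcongr
      rw [← dist_eq_norm]
      exact hρK.dist_le_mul x y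
    · refine (norm_add_le _ _).trans ?_
      push_cast
      gcongr
      · refine (hC t ht _).trans ?_
        gcongr
        exact hρM x
      · exact hc t ht
    · simp [hT]
  obtain ⟨x, hx0, hx⟩ := hPL.exists_eq_forall_mem_Icc_hasDerivWithinAt₀
  refine ⟨x, hx0, fun t ht => ?_⟩
  have hbound := norm_le_gronwallBound_of_norm_deriv_right_le (K := C) (ε := c) (δ := 0)
    (fun s hs => (hx s hs).continuousWithinAt)
    (fun s hs => (hx s (Ico_subset_Icc_self hs)).mono_of_mem_nhdsWithin
      (Icc_mem_nhdsGE_of_mem hs))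
    (by simpa using hx0)
    (fun s hs => by
      have hs := Ico_subset_Icc_self hs
      refine (norm_add_le _ _).trans (add_le_add ((hC s hs _).trans ?_) (hc s hs))
      gcongr
      exact hρle _) t ht
  have := hx t ht
  rwa [hρid] at this
  rw [sub_zero] at hbound
  linarith [hmono ht.2]

/-- Global existence for linear terminal value problems on a compact interval. -/
theorem exists_linearODE_terminal {T : ℝ} (hT : 0 ≤ T) {L : ℝ → E →ₗ[ℝ] E} {b : ℝ → E}
    (hL : ∀ x, ContinuousOn (fun t => L t x) (Icc 0 T)) (hb : ContinuousOn b (Icc 0 T)) :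
    ∃ x : ℝ → E, x T = 0 ∧
      ∀ t ∈ Icc 0 T, HasDerivWithinAt x (L t (x t) + b t) (Icc 0 T) t := by
  have hmaps : MapsTo (fun t => T - t) (Icc 0 T) (Icc 0 T) := fun t ht =>
    ⟨sub_nonneg.2 ht.2, sub_le_self _ ht.1⟩
  have hcont : ContinuousOn (fun t => T - t) (Icc 0 T) := by fun_prop
  obtain ⟨y, hy0, hy⟩ := exists_linearODE_initial hT (L := fun t => -L (T - t))
    (b := fun t => -b (T - t)) (fun x => ((hL x).comp hcont hmaps).neg)
    (hb.comp hcont hmaps).neg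
  refine ⟨fun t => y (T - t), by simpa using hy0, fun t ht => ?_⟩
  have hd : HasDerivWithinAt (fun t : ℝ => T - t) (-1) (Icc 0 T) t :=
    ((hasDerivAt_id t).const_sub T).hasDerivWithinAt
  simpa [add_comm, Function.comp_def] using (hy (T - t) (hmaps ht)).scomp t hd hmaps

/-- A solution of a homogeneous linear equation vanishing at the terminal time vanishes. -/
theorem eq_zero_of_linearODE_terminal {T : ℝ} {L : ℝ → E →ₗ[ℝ] E}
    (hL : ∀ x, ContinuousOn (fun t => L t x) (Icc 0 T)) {x : ℝ → E} (hxT : x T = 0)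
    (hx : ∀ t ∈ Icc 0 T, HasDerivWithinAt x (L t (x t)) (Icc 0 T) t) :
    ∀ t ∈ Icc 0 T, x t = 0 := by
  obtain ⟨C, hC⟩ := exists_norm_le_of_continuousOn_Icc hL
  refine ODE_solution_unique_of_mem_Icc_left (v := fun t => L t) (K := C) (s := fun _ => univ)
    (g := fun _ => 0)
    (fun t ht => LipschitzWith.lipschitzOnWith (LipschitzWith.of_dist_le_mul fun y z => ?_))
    (fun t ht => (hx t ht).continuousWithinAt)
    (fun t ht => (hx t (Ioc_subset_Icc_self ht)).mono_of_mem_nhdsWithin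
      (Icc_mem_nhdsLE_of_mem ht))
    (fun _ _ => trivial) continuousOn_const (fun t _ => ?_) (fun _ _ => trivial) hxT
  · rw [dist_eq_norm, dist_eq_norm, ← map_sub]
    exact hC t (Ioc_subset_Icc_self ht) _
  · simpa using hasDerivWithinAt_const t (Iic t) (0 : E)

end LinearODE

namespace Params

variable {n n₁ : ℕ} (p : Params n n₁) (N : ℕ)

/-! ### Block permutations -/

/-- The permutation of the index set `Fin N × Fin m` permuting the blocks by `σ`. -/
def blockPerm {N : ℕ} (σ : Equiv.Perm (Fin N)) (m : ℕ) : Fin N × Fin m ≃ Fin N × Fin m :=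
  σ.prodCongr (Equiv.refl _)

variable {N} (σ : Equiv.Perm (Fin N))

theorem bigA_submatrix : (p.bigA N).submatrix (blockPerm σ n) (blockPerm σ n) = p.bigA N := by
  ext x y; simp [bigA, blockPerm]

theorem bigQ_submatrix : (p.bigQ N).submatrix (blockPerm σ n) (blockPerm σ n) = p.bigQ N := by
  ext x y; simp [bigQ, blockPerm]

theorem bigQf_submatrix : (p.bigQf N).submatrix (blockPerm σ n) (blockPerm σ n) = p.bigQf N := by
  ext x y; simp [bigQf, blockPerm]

theorem bigR_submatrix : (p.bigR N).submatrix (blockPerm σ n₁) (blockPerm σ n₁) = p.bigR N := by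
  ext x y; simp [bigR, blockPerm]

theorem bigBhat_submatrix :
    (p.bigBhat N).submatrix (blockPerm σ n) (blockPerm σ n₁) = p.bigBhat N := by
  ext x y; simp [bigBhat, blockPerm]

theorem bigB_submatrix (i : Fin N) :
    (p.bigB N (σ i)).submatrix (blockPerm σ n) (Equiv.refl _) = p.bigB N i := by
  ext x y; simp [bigB, blockPerm]

theorem bigD_submatrix (i : Fin N) :
    (p.bigD N (σ i)).submatrix (blockPerm σ n) (Equiv.refl _) = p.bigD N i := by
  ext x y; simp [bigD, blockPerm]

theorem bigE_submatrix (i : Fin N) :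
    (p.bigE N (σ i)).submatrix (Equiv.refl _) (blockPerm σ n₁) = p.bigE N i := by
  ext x y; simp [bigE, blockPerm]

theorem bigB0_submatrix :
    (p.bigB0 N).submatrix (blockPerm σ n) (Equiv.refl _) = p.bigB0 N := by
  ext x y; simp [bigB0, blockPerm]

theorem bigD0_submatrix :
    (p.bigD0 N).submatrix (blockPerm σ n) (Equiv.refl _) = p.bigD0 N := by
  ext x y; simp [bigD0, blockPerm]

theorem bigIhat_submatrix :
    (p.bigIhat N).submatrix (Equiv.refl _) (blockPerm σ n₁) = p.bigIhat N := by
  ext x y; simp [bigIhat, blockPerm]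

theorem M1_submatrix (Z : Matrix (Fin N × Fin n) (Fin N × Fin n) ℝ) :
    p.M1 N (Z.submatrix (blockPerm σ n) (blockPerm σ n)) =
      (p.M1 N Z).submatrix (Equiv.refl _) (blockPerm σ n₁) := by
  have hi (i : Fin N) : (p.bigD N i)ᵀ * Z.submatrix (blockPerm σ n) (blockPerm σ n) *
        p.bigB N i * p.bigE N i =
      ((p.bigD N (σ i))ᵀ * Z * p.bigB N (σ i) * p.bigE N (σ i)).submatrix (Equiv.refl _)
        (blockPerm σ n₁) := by
    rw [← bigD_submatrix p σ, ← bigB_submatrix p σ, ← bigE_submatrix p σ]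
    simp only [transpose_submatrix, submatrix_mul_equiv]
  have h0 : (p.bigD0 N)ᵀ * Z.submatrix (blockPerm σ n) (blockPerm σ n) *
        p.bigB0 N * p.bigIhat N =
      ((p.bigD0 N)ᵀ * Z * p.bigB0 N * p.bigIhat N).submatrix (Equiv.refl _)
        (blockPerm σ n₁) := by
    conv_lhs => rw [← bigD0_submatrix p σ, ← bigB0_submatrix p σ, ← bigIhat_submatrix p σ]
    simp only [transpose_submatrix, submatrix_mul_equiv]
  rw [M1, M1, h0, Finset.sum_congr rfl fun i _ => hi i,
    ← Equiv.sum_comp σ fun i => (p.bigD N i)ᵀ * Z * p.bigB N i * p.bigE N i]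
  ext x y
  simp [Matrix.sum_apply]

theorem M2_submatrix (Z : Matrix (Fin N × Fin n) (Fin N × Fin n) ℝ) :
    p.M2 N (Z.submatrix (blockPerm σ n) (blockPerm σ n)) =
      (p.M2 N Z).submatrix (blockPerm σ n₁) (blockPerm σ n₁) := by
  have hi (i : Fin N) : (p.bigE N i)ᵀ * (p.bigB N i)ᵀ *
        Z.submatrix (blockPerm σ n) (blockPerm σ n) * p.bigB N i * p.bigE N i =
      ((p.bigE N (σ i))ᵀ * (p.bigB N (σ i))ᵀ * Z * p.bigB N (σ i) * p.bigE N (σ i)).submatrix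
        (blockPerm σ n₁) (blockPerm σ n₁) := by
    rw [← bigB_submatrix p σ, ← bigE_submatrix p σ]
    simp only [transpose_submatrix, submatrix_mul_equiv]
  have h0 : (p.bigIhat N)ᵀ * (p.bigB0 N)ᵀ * Z.submatrix (blockPerm σ n) (blockPerm σ n) *
        p.bigB0 N * p.bigIhat N =
      ((p.bigIhat N)ᵀ * (p.bigB0 N)ᵀ * Z * p.bigB0 N * p.bigIhat N).submatrix
        (blockPerm σ n₁) (blockPerm σ n₁) := by
    conv_lhs => rw [← bigB0_submatrix p σ, ← bigIhat_submatrix p σ]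
    simp only [transpose_submatrix, submatrix_mul_equiv]
  rw [M2, M2, h0, Finset.sum_congr rfl fun i _ => hi i,
    ← Equiv.sum_comp σ fun i =>
      (p.bigE N i)ᵀ * (p.bigB N i)ᵀ * Z * p.bigB N i * p.bigE N i]
  ext x y
  simp [Matrix.sum_apply]

theorem bigR_add_M2_submatrix (Z : Matrix (Fin N × Fin n) (Fin N × Fin n) ℝ) :
    p.bigR N + (2 : ℝ) • p.M2 N (Z.submatrix (blockPerm σ n) (blockPerm σ n)) =
      (p.bigR N + (2 : ℝ) • p.M2 N Z).submatrix (blockPerm σ n₁) (blockPerm σ n₁) := by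
  rw [M2_submatrix]
  conv_lhs => rw [← bigR_submatrix p σ]
  rfl

theorem PRic_submatrix (Z : Matrix (Fin N × Fin n) (Fin N × Fin n) ℝ) :
    p.PRic N (Z.submatrix (blockPerm σ n) (blockPerm σ n)) =
      (p.PRic N Z).submatrix (blockPerm σ n) (blockPerm σ n) := by
  rw [PRic, bigR_add_M2_submatrix, inv_submatrix_equiv]
  conv_lhs => rw [← bigBhat_submatrix p σ, ← bigA_submatrix p σ, ← bigQ_submatrix p σ]
  simp only [transpose_submatrix, submatrix_mul_equiv]
  rfl

variable {p} in
theorem IsSolP.submatrix {P : ℝ → Matrix (Fin N × Fin n) (Fin N × Fin n) ℝ} (hP : p.IsSolP N P) :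
    p.IsSolP N fun t => (P t).submatrix (blockPerm σ n) (blockPerm σ n) := by
  obtain ⟨hsymm, hpos, hT, hd⟩ := hP
  refine ⟨fun t ht => (hsymm t ht).submatrix _, fun t ht => ?_, ?_, fun t ht x y => ?_⟩
  · rw [bigR_add_M2_submatrix]
    exact (hpos t ht).submatrix (blockPerm σ n₁).injective
  · simp only [hT, bigQf_submatrix]
  · rw [PRic_submatrix]
    exact hd t ht _ _

theorem companion_submatrix (Z : Matrix (Fin N × Fin n) (Fin N × Fin n) ℝ)
    (S : Matrix (Fin N × Fin n) (Fin 1) ℝ) :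
    Z.submatrix (blockPerm σ n) (blockPerm σ n) * p.bigBhat N *
        (p.bigR N + (2 : ℝ) • p.M2 N (Z.submatrix (blockPerm σ n) (blockPerm σ n)))⁻¹ *
        ((p.bigBhat N)ᵀ * S.submatrix (blockPerm σ n) (Equiv.refl _) +
          (p.M1 N (Z.submatrix (blockPerm σ n) (blockPerm σ n)))ᵀ) -
        (p.bigA N)ᵀ * S.submatrix (blockPerm σ n) (Equiv.refl _) =
      (Z * p.bigBhat N * (p.bigR N + (2 : ℝ) • p.M2 N Z)⁻¹ *
        ((p.bigBhat N)ᵀ * S + (p.M1 N Z)ᵀ) - (p.bigA N)ᵀ * S).submatrix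
        (blockPerm σ n) (Equiv.refl _) := by
  rw [bigR_add_M2_submatrix, inv_submatrix_equiv, M1_submatrix]
  conv_lhs => rw [← bigBhat_submatrix p σ, ← bigA_submatrix p σ]
  simp only [Matrix.mul_add, transpose_submatrix, submatrix_mul_equiv]
  rfl

variable {p} in
theorem IsSolS.submatrix {P : ℝ → Matrix (Fin N × Fin n) (Fin N × Fin n) ℝ}
    {S : ℝ → Matrix (Fin N × Fin n) (Fin 1) ℝ} (hS : p.IsSolS N P S) :
    p.IsSolS N (fun t => (P t).submatrix (blockPerm σ n) (blockPerm σ n))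
      fun t => (S t).submatrix (blockPerm σ n) (Equiv.refl _) := by
  refine ⟨by simp only [hS.1]; rfl, fun t ht x y => ?_⟩
  rw [companion_submatrix]
  exact hS.2 t ht _ _

/-! ### The vector fields of the Riccati and companion equations -/

variable (N)

theorem M1_continuous : Continuous (p.M1 N) := by
  unfold M1
  fun_prop

theorem M2_continuous : Continuous (p.M2 N) := by
  unfold M2
  fun_prop

theorem M2_add (X Y : Matrix (Fin N × Fin n) (Fin N × Fin n) ℝ) :
    p.M2 N (X + Y) = p.M2 N X + p.M2 N Y := by
  simp only [M2, Matrix.mul_add, Matrix.add_mul, Finset.sum_add_distrib, smul_add]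
  abel

theorem M2_smul (c : ℝ) (X : Matrix (Fin N × Fin n) (Fin N × Fin n) ℝ) :
    p.M2 N (c • X) = c • p.M2 N X := by
  simp only [M2, Matrix.mul_smul, Matrix.smul_mul, ← Finset.smul_sum, smul_add, smul_comm c]

/-- The linear map whose value at `P₁ - P₂` is the difference of the Riccati vector field at
`P₁` and `P₂`, where `K₁` and `K₂` are the inverses of the weights `𝐑 + 2𝓜₂(Pᵢ)`. -/
noncomputable def riccatiDiff (P₁ P₂ : Matrix (Fin N × Fin n) (Fin N × Fin n) ℝ)
    (K₁ K₂ : Matrix (Fin N × Fin n₁) (Fin N × Fin n₁) ℝ) :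
    Matrix (Fin N × Fin n) (Fin N × Fin n) ℝ →ₗ[ℝ] Matrix (Fin N × Fin n) (Fin N × Fin n) ℝ where
  toFun X := X * p.bigBhat N * K₁ * (p.bigBhat N)ᵀ * P₁
    - P₂ * p.bigBhat N * (K₁ * ((2 : ℝ) • p.M2 N X) * K₂) * (p.bigBhat N)ᵀ * P₁
    + P₂ * p.bigBhat N * K₂ * (p.bigBhat N)ᵀ * X - X * p.bigA N - (p.bigA N)ᵀ * X
  map_add' X Y := by
    simp only [M2_add, Matrix.mul_add, Matrix.add_mul, smul_add]
    abel
  map_smul' c X := by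
    simp only [M2_smul, Matrix.mul_smul, Matrix.smul_mul, smul_sub, smul_add, smul_comm c,
      RingHom.id_apply]

theorem PRic_sub {P₁ P₂ : Matrix (Fin N × Fin n) (Fin N × Fin n) ℝ}
    (h₁ : IsUnit (p.bigR N + (2 : ℝ) • p.M2 N P₁).det)
    (h₂ : IsUnit (p.bigR N + (2 : ℝ) • p.M2 N P₂).det) :
    p.PRic N P₁ - p.PRic N P₂ = p.riccatiDiff N P₁ P₂ (p.bigR N + (2 : ℝ) • p.M2 N P₁)⁻¹
      (p.bigR N + (2 : ℝ) • p.M2 N P₂)⁻¹ (P₁ - P₂) := by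
  have hM : (2 : ℝ) • p.M2 N (P₁ - P₂) =
      (p.bigR N + (2 : ℝ) • p.M2 N P₁) - (p.bigR N + (2 : ℝ) • p.M2 N P₂) := by
    rw [sub_eq_add_neg P₁, ← neg_one_smul ℝ, M2_add, M2_smul]
    module
  simp only [PRic, riccatiDiff, LinearMap.coe_mk, AddHom.coe_mk, hM]
  generalize p.bigR N + (2 : ℝ) • p.M2 N P₁ = W₁ at *
  generalize p.bigR N + (2 : ℝ) • p.M2 N P₂ = W₂ at *
  have hK : W₁⁻¹ * (W₁ - W₂) * W₂⁻¹ = W₂⁻¹ - W₁⁻¹ := by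
    rw [Matrix.mul_sub, Matrix.sub_mul, Matrix.nonsing_inv_mul _ h₁, Matrix.mul_assoc W₁⁻¹,
      Matrix.mul_nonsing_inv _ h₂, Matrix.one_mul, Matrix.mul_one]
  rw [hK]
  simp only [Matrix.mul_sub, Matrix.sub_mul]
  abel

/-- The linear part of the vector field of (ODE-S), with `K` the inverse of `𝐑 + 2𝓜₂(𝐏)`. -/
noncomputable def companionLinear (Z : Matrix (Fin N × Fin n) (Fin N × Fin n) ℝ)
    (K : Matrix (Fin N × Fin n₁) (Fin N × Fin n₁) ℝ) :
    Matrix (Fin N × Fin n) (Fin 1) ℝ →ₗ[ℝ] Matrix (Fin N × Fin n) (Fin 1) ℝ where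
  toFun S := Z * p.bigBhat N * K * ((p.bigBhat N)ᵀ * S) - (p.bigA N)ᵀ * S
  map_add' X Y := by
    simp only [Matrix.mul_add]
    abel
  map_smul' c X := by
    simp only [Matrix.mul_smul, smul_sub, RingHom.id_apply]

theorem continuousOn_matrix_mul {a b c : Type*} [Fintype b] {X : ℝ → Matrix a b ℝ}
    {Y : ℝ → Matrix b c ℝ} {s : Set ℝ} (hX : ContinuousOn X s) (hY : ContinuousOn Y s) :
    ContinuousOn (fun t => X t * Y t) s :=
  (continuous_fst.matrix_mul continuous_snd).comp_continuousOn (hX.prodMk hY)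

variable {N} in
theorem continuousOn_riccatiDiff {P₁ P₂ : ℝ → Matrix (Fin N × Fin n) (Fin N × Fin n) ℝ}
    {K₁ K₂ : ℝ → Matrix (Fin N × Fin n₁) (Fin N × Fin n₁) ℝ} {s : Set ℝ}
    (hP₁ : ContinuousOn P₁ s) (hP₂ : ContinuousOn P₂ s) (hK₁ : ContinuousOn K₁ s)
    (hK₂ : ContinuousOn K₂ s) (X : Matrix (Fin N × Fin n) (Fin N × Fin n) ℝ) :
    ContinuousOn (fun t => p.riccatiDiff N (P₁ t) (P₂ t) (K₁ t) (K₂ t) X) s := by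
  have hB : ContinuousOn (fun _ : ℝ => p.bigBhat N) s := continuousOn_const
  have hB' : ContinuousOn (fun _ : ℝ => (p.bigBhat N)ᵀ) s := continuousOn_const
  have hX : ContinuousOn (fun _ : ℝ => X) s := continuousOn_const
  have hM : ContinuousOn (fun _ : ℝ => (2 : ℝ) • p.M2 N X) s := continuousOn_const
  have h₁ := continuousOn_matrix_mul (continuousOn_matrix_mul (continuousOn_matrix_mul
    (continuousOn_matrix_mul hX hB) hK₁) hB') hP₁
  have h₂ := continuousOn_matrix_mul (continuousOn_matrix_mul (continuousOn_matrix_mul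
    (continuousOn_matrix_mul hP₂ hB)
    (continuousOn_matrix_mul (continuousOn_matrix_mul hK₁ hM) hK₂)) hB') hP₁
  have h₃ := continuousOn_matrix_mul (continuousOn_matrix_mul (continuousOn_matrix_mul
    (continuousOn_matrix_mul hP₂ hB) hK₂) hB') hX
  exact (((h₁.sub h₂).add h₃).sub continuousOn_const).sub continuousOn_const

variable {N} in
theorem continuousOn_companionLinear {Z : ℝ → Matrix (Fin N × Fin n) (Fin N × Fin n) ℝ}
    {K : ℝ → Matrix (Fin N × Fin n₁) (Fin N × Fin n₁) ℝ} {s : Set ℝ} (hZ : ContinuousOn Z s)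
    (hK : ContinuousOn K s) (S : Matrix (Fin N × Fin n) (Fin 1) ℝ) :
    ContinuousOn (fun t => p.companionLinear N (Z t) (K t) S) s :=
  (continuousOn_matrix_mul (continuousOn_matrix_mul
    (continuousOn_matrix_mul hZ continuousOn_const) hK) continuousOn_const).sub continuousOn_const

variable {N} in
theorem continuousOn_companionForcing {Z : ℝ → Matrix (Fin N × Fin n) (Fin N × Fin n) ℝ}
    {K : ℝ → Matrix (Fin N × Fin n₁) (Fin N × Fin n₁) ℝ} {s : Set ℝ} (hZ : ContinuousOn Z s)
    (hK : ContinuousOn K s) :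
    ContinuousOn (fun t => Z t * p.bigBhat N * K t * (p.M1 N (Z t))ᵀ) s :=
  continuousOn_matrix_mul (continuousOn_matrix_mul
    (continuousOn_matrix_mul hZ continuousOn_const) hK)
    ((p.M1_continuous N).matrix_transpose.comp_continuousOn hZ)

/-! ### Well-posedness of the Riccati and companion equations -/

section ODE

open scoped Matrix.Norms.Elementwise

theorem hasDerivWithinAt_matrix {a b : Type*} [Fintype a] [Fintype b] {F : ℝ → Matrix a b ℝ}
    {F' : Matrix a b ℝ} {s : Set ℝ} {t : ℝ} :
    HasDerivWithinAt F F' s t ↔ ∀ i j, HasDerivWithinAt (fun t => F t i j) (F' i j) s t :=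
  hasDerivWithinAt_pi.trans (forall_congr' fun _ => hasDerivWithinAt_pi)

variable {p N} {P : ℝ → Matrix (Fin N × Fin n) (Fin N × Fin n) ℝ}

theorem IsSolP.continuousOn (hP : p.IsSolP N P) : ContinuousOn P (Icc 0 p.T) := fun t ht =>
  (hasDerivWithinAt_matrix.2 (hP.2.2.2 t ht)).continuousWithinAt

theorem IsSolP.isUnit_det (hP : p.IsSolP N P) {t : ℝ} (ht : t ∈ Icc 0 p.T) :
    IsUnit (p.bigR N + (2 : ℝ) • p.M2 N (P t)).det :=
  (Matrix.isUnit_iff_isUnit_det _).1 (hP.2.1 t ht).isUnit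

theorem IsSolP.continuousOn_inv (hP : p.IsSolP N P) :
    ContinuousOn (fun t => (p.bigR N + (2 : ℝ) • p.M2 N (P t))⁻¹) (Icc 0 p.T) := by
  have hM := p.M2_continuous N
  have hW : Continuous fun Z => p.bigR N + (2 : ℝ) • p.M2 N Z := by fun_prop
  simp only [Matrix.inv_def, Ring.inverse_eq_inv']
  refine ContinuousOn.smul (ContinuousOn.inv₀ ?_ fun t ht => (hP.isUnit_det ht).ne_zero) ?_
  · exact hW.matrix_det.comp_continuousOn hP.continuousOn
  · exact hW.matrix_adjugate.comp_continuousOn hP.continuousOn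

/-- Solutions of the Riccati equation (ODE-P) are unique. -/
theorem IsSolP.eq {P' : ℝ → Matrix (Fin N × Fin n) (Fin N × Fin n) ℝ} (hP : p.IsSolP N P)
    (hP' : p.IsSolP N P') {t : ℝ} (ht : t ∈ Icc 0 p.T) : P t = P' t := by
  refine sub_eq_zero.1 (eq_zero_of_linearODE_terminal
    (L := fun t => p.riccatiDiff N (P t) (P' t) (p.bigR N + (2 : ℝ) • p.M2 N (P t))⁻¹
      (p.bigR N + (2 : ℝ) • p.M2 N (P' t))⁻¹) (x := fun t => P t - P' t) (fun X => ?_) ?_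
      (fun s hs => ?_) t ht)
  · exact p.continuousOn_riccatiDiff hP.continuousOn hP'.continuousOn hP.continuousOn_inv
      hP'.continuousOn_inv X
  · simp only [hP.2.2.1, hP'.2.2.1, sub_self]
  · rw [← PRic_sub p N (hP.isUnit_det hs) (hP'.isUnit_det hs)]
    exact (hasDerivWithinAt_matrix.2 (hP.2.2.2 s hs)).sub
      (hasDerivWithinAt_matrix.2 (hP'.2.2.2 s hs))

/-- The companion equation (ODE-S) is solvable. -/
theorem IsSolP.exists_isSolS (hP : p.IsSolP N P) (hT : 0 ≤ p.T) : ∃ S, p.IsSolS N P S := by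
  obtain ⟨S, hST, hS⟩ := exists_linearODE_terminal hT
    (p.continuousOn_companionLinear hP.continuousOn hP.continuousOn_inv)
    (b := fun t => P t * p.bigBhat N * (p.bigR N + (2 : ℝ) • p.M2 N (P t))⁻¹ * (p.M1 N (P t))ᵀ)
    (p.continuousOn_companionForcing hP.continuousOn hP.continuousOn_inv)
  refine ⟨S, hST, fun t ht => hasDerivWithinAt_matrix.1 ((hS t ht).congr_deriv ?_)⟩
  simp only [companionLinear, LinearMap.coe_mk, AddHom.coe_mk, Matrix.mul_add]
  abel

/-- Solutions of the companion equation (ODE-S) are unique. -/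
theorem IsSolS.eq {S S' : ℝ → Matrix (Fin N × Fin n) (Fin 1) ℝ} (hP : p.IsSolP N P)
    (hS : p.IsSolS N P S) (hS' : p.IsSolS N P S') {t : ℝ} (ht : t ∈ Icc 0 p.T) :
    S t = S' t := by
  refine sub_eq_zero.1 (eq_zero_of_linearODE_terminal
    (p.continuousOn_companionLinear hP.continuousOn hP.continuousOn_inv)
    (x := fun t => S t - S' t) ?_ (fun s hs => ?_) t ht)
  · simp only [hS.1, hS'.1, sub_self]
  · refine ((hasDerivWithinAt_matrix.2 (hS.2 s hs)).sub
      (hasDerivWithinAt_matrix.2 (hS'.2 s hs))).congr_deriv ?_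
    simp only [companionLinear, LinearMap.coe_mk, AddHom.coe_mk, Matrix.mul_add, Matrix.mul_sub]
    abel

end ODE

theorem IsSolS.congr {p : Params n n₁} {N : ℕ}
    {P P' : ℝ → Matrix (Fin N × Fin n) (Fin N × Fin n) ℝ}
    {S : ℝ → Matrix (Fin N × Fin n) (Fin 1) ℝ} (hS : p.IsSolS N P S)
    (h : ∀ t ∈ Icc 0 p.T, P t = P' t) : p.IsSolS N P' S :=
  ⟨hS.1, fun t ht => h t ht ▸ hS.2 t ht⟩

end Params

/-- given a solution of (ODE-P), the linear terminal value problem (ODE-S)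
has a unique solution on [0,T], all of whose N blocks are equal. -/
theorem solS_exists_unique_equal_blocks {n n₁ : ℕ} (p : Params n n₁) (hp : p.Standing)
    (N : ℕ) (hN : 1 ≤ N)
    (P : ℝ → Matrix (Fin N × Fin n) (Fin N × Fin n) ℝ) (hP : p.IsSolP N P) :
    ∃ S : ℝ → Matrix (Fin N × Fin n) (Fin 1) ℝ,
      p.IsSolS N P S ∧
      (∀ S' : ℝ → Matrix (Fin N × Fin n) (Fin 1) ℝ,
        p.IsSolS N P S' → ∀ t ∈ Icc (0 : ℝ) p.T, S' t = S t) ∧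
      ∃ SN : ℝ → Matrix (Fin n) (Fin 1) ℝ,
        ∀ t ∈ Icc (0 : ℝ) p.T, ∀ (i : Fin N) (k : Fin n) (j : Fin 1),
          S t (i, k) j = SN t k j := by
  obtain ⟨S, hS⟩ := hP.exists_isSolS hp.2.2.1.le
  refine ⟨S, hS, fun S' hS' t ht => hS'.eq hP hS ht,
    fun t => (S t).submatrix (fun k => (⟨0, hN⟩, k)) id, fun t ht i k j => ?_⟩
  have hσ := (hS.submatrix (Equiv.swap ⟨0, hN⟩ i)).congr fun t ht => (hP.submatrix _).eq hP ht
  have := congrFun₂ (hS.eq hP hσ ht) (i, k) j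
  simpa [Params.blockPerm] using this

end LQ
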